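/- Assume conditions (1.2) and (1.3), let u, v be a principal fundamental system of solutions of (r z')' = q z, and let p ∈ (1,∞). If any one of the following three conditions holds, then the Green operator G is a bounded and compact operator on L_p(ℝ): (1) sup_{x∈ℝ} r(x) h(x)² < ∞ and r(x) h(x)² → 0 as |x| → ∞; (2) sup_{x∈ℝ} r(x) φ(x) ψ(x) < ∞ and r(x) φ(x) ψ(x) → 0 as |x| → ∞; (3) sup_{x∈ℝ} h(x)·|x| < ∞ and h(x)·|x| → 0 as |x| → ∞. -/

import Mathlib

open MeasureTheory Filter Topology
open scoped ENNReal RealInnerProductSpace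

noncomputable section

/-- Conditions (1.2): `r, q` measurable, `r > 0`, `q ≥ 0`, with `1/r` and `q`
locally Lebesgue integrable on `ℝ`. -/
def Cond12 (r q : ℝ → ℝ) : Prop :=
  Measurable r ∧ Measurable q ∧ (∀ x, 0 < r x) ∧ (∀ x, 0 ≤ q x) ∧
    LocallyIntegrable (fun t => 1 / r t) volume ∧ LocallyIntegrable q volume

/-- Condition (1.3): for every `x`,
`(∫_{x-d}^x dt/r(t)) · (∫_{x-d}^x q(t) dt) → ∞` as `|d| → ∞`. -/
def Cond13 (r q : ℝ → ℝ) : Prop :=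
  ∀ x : ℝ, Tendsto (fun d : ℝ => (∫ t in x - d..x, 1 / r t) * (∫ t in x - d..x, q t))
    (cocompact ℝ) atTop

/-- Condition (2.1): `∫_{-∞}^x q > 0` and `∫_x^∞ q > 0` for every `x`. -/
def Cond21 (q : ℝ → ℝ) : Prop :=
  ∀ x : ℝ, 0 < ∫⁻ t in Set.Iic x, ENNReal.ofReal (q t) ∧
    0 < ∫⁻ t in Set.Ici x, ENNReal.ofReal (q t)

/-- A principal fundamental system of solutions `u, v` (with a.e. derivatives
`u', v'`) of the equation `(r z')' = q z`:  `u, v, r u', r v'` are locally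
absolutely continuous (expressed through the integral identities below),
`(r u')' = q u` and `(r v')' = q v` a.e., `u > 0`, `v > 0`, `v' ≥ 0`, `u' ≤ 0`,
`r (v' u - u' v) ≡ 1`, `v/u → 0` at `-∞`, `u/v → 0` at `+∞`,
`∫_{-∞}^0 dt/(r u²) < ∞` and `∫_0^∞ dt/(r v²) < ∞`. -/
structure PFSS (r q u v u' v' : ℝ → ℝ) : Prop where
  u_pos : ∀ x, 0 < u x
  v_pos : ∀ x, 0 < v x
  u'_nonpos : ∀ x, u' x ≤ 0
  v'_nonneg : ∀ x, 0 ≤ v' x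
  u'_intble : ∀ a b : ℝ, IntervalIntegrable u' volume a b
  v'_intble : ∀ a b : ℝ, IntervalIntegrable v' volume a b
  u_deriv : ∀ a b : ℝ, u b - u a = ∫ t in a..b, u' t
  v_deriv : ∀ a b : ℝ, v b - v a = ∫ t in a..b, v' t
  ru'_deriv : ∀ a b : ℝ, r b * u' b - r a * u' a = ∫ t in a..b, q t * u t
  rv'_deriv : ∀ a b : ℝ, r b * v' b - r a * v' a = ∫ t in a..b, q t * v t
  wronskian : ∀ x, r x * (v' x * u x - u' x * v x) = 1
  ratio_bot : Tendsto (fun x => v x / u x) atBot (𝓝 0)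
  ratio_top : Tendsto (fun x => u x / v x) atTop (𝓝 0)
  int_u : ∫⁻ t in Set.Iic (0:ℝ), ENNReal.ofReal (1 / (r t * u t ^ 2)) < ⊤
  int_v : ∫⁻ t in Set.Ici (0:ℝ), ENNReal.ofReal (1 / (r t * v t ^ 2)) < ⊤

/-- The Green kernel `G(x,t) = u(x) v(t)` for `x ≥ t`, `u(t) v(x)` for `x ≤ t`. -/
def greenKernel (u v : ℝ → ℝ) (x t : ℝ) : ℝ :=
  if t ≤ x then u x * v t else u t * v x

/-- The space `L_p(ℝ)` (with respect to Lebesgue measure). -/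
abbrev LpR (p : ℝ≥0∞) : Type := Lp ℝ p (volume : Measure ℝ)

/-- `G` is (a bounded realization on `L_p` of) the Green operator
`(G f)(x) = ∫_ℝ G(x,t) f(t) dt`. -/
def IsGreenOp (u v : ℝ → ℝ) (p : ℝ≥0∞) [Fact (1 ≤ p)]
    (G : LpR p →L[ℝ] LpR p) : Prop :=
  ∀ f : LpR p,
    (G f : ℝ → ℝ) =ᵐ[volume] fun x => ∫ t, greenKernel u v x t * (f : ℝ → ℝ) t

/-- `d₁` solves `(∫_{x-d}^x dt/r)(∫_{x-d}^x q dt) = 1`, `d₁ > 0`. -/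
def IsD1 (r q d₁ : ℝ → ℝ) : Prop :=
  ∀ x : ℝ, 0 < d₁ x ∧
    (∫ t in x - d₁ x..x, 1 / r t) * (∫ t in x - d₁ x..x, q t) = 1

/-- `d₂` solves `(∫_x^{x+d} dt/r)(∫_x^{x+d} q dt) = 1`, `d₂ > 0`. -/
def IsD2 (r q d₂ : ℝ → ℝ) : Prop :=
  ∀ x : ℝ, 0 < d₂ x ∧
    (∫ t in x..x + d₂ x, 1 / r t) * (∫ t in x..x + d₂ x, q t) = 1

/-- `φ(x) = ∫_{x-d₁(x)}^x dt/r(t)`. -/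
def phiF (r d₁ : ℝ → ℝ) (x : ℝ) : ℝ := ∫ t in x - d₁ x..x, 1 / r t

/-- `ψ(x) = ∫_x^{x+d₂(x)} dt/r(t)`. -/
def psiF (r d₂ : ℝ → ℝ) (x : ℝ) : ℝ := ∫ t in x..x + d₂ x, 1 / r t

/-- `h(x) = φ(x)ψ(x)/(φ(x)+ψ(x))`. -/
def hF (r d₁ d₂ : ℝ → ℝ) (x : ℝ) : ℝ :=
  phiF r d₁ x * psiF r d₂ x / (phiF r d₁ x + psiF r d₂ x)

/-- `d` solves `∫_{x-d(x)}^{x+d(x)} dt/(r(t)h(t)) = 1`, `d > 0`. -/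
def IsD (r h d : ℝ → ℝ) : Prop :=
  ∀ x : ℝ, 0 < d x ∧ (∫ t in x - d x..x + d x, 1 / (r t * h t)) = 1

/-- `s` solves `∫_{x-s(x)}^{x+s(x)} dt/(r(t)ρ(t)) = 1`, `s > 0`. -/
def IsS (r ρ s : ℝ → ℝ) : Prop :=
  ∀ x : ℝ, 0 < s x ∧ (∫ t in x - s x..x + s x, 1 / (r t * ρ t)) = 1


/-- A measurable kernel `K` satisfies the Schur bound with constant `C` and weight `w` (for the
conjugate exponents `p, q`). -/
structure SchurBound {α : Type*} [MeasurableSpace α] (μ : Measure α) (p q : ℝ) (w : α → ℝ≥0∞)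
    (C : ℝ≥0∞) (K : α → α → ℝ) : Prop where
  meas : Measurable (Function.uncurry K)
  left : ∀ x, ∫⁻ t, ‖K x t‖ₑ * w t ^ p⁻¹ ∂μ ≤ C * w x ^ p⁻¹
  right : ∀ t, ∫⁻ x, ‖K x t‖ₑ * w x ^ q⁻¹ ∂μ ≤ C * w t ^ q⁻¹

section Schur

variable {α : Type*} [MeasurableSpace α] {μ : Measure α} {p q : ℝ} {w : α → ℝ≥0∞} {C : ℝ≥0∞}
  {K K₁ K₂ : α → α → ℝ}

theorem SchurBound.mono (h : SchurBound μ p q w C K₁) (hK : Measurable (Function.uncurry K₂))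
    (hle : ∀ x t, ‖K₂ x t‖ₑ ≤ ‖K₁ x t‖ₑ) : SchurBound μ p q w C K₂ where
  meas := hK
  left x := (lintegral_mono fun t => mul_le_mul_left (hle x t) _).trans (h.left x)
  right t := (lintegral_mono fun x => mul_le_mul_left (hle x t) _).trans (h.right t)

theorem SchurBound.lintegral_rpow_le_apply (h : SchurBound μ p q w C K) (hpq : p.HolderConjugate q)
    (hw : Measurable w) (hw0 : ∀ x, w x ≠ 0) (hwt : ∀ x, w x ≠ ⊤)
    {f : α → ℝ≥0∞} (hf : Measurable f) (x : α) :
    (∫⁻ t, ‖K x t‖ₑ * f t ∂μ) ^ p ≤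
      C ^ (p / q) * w x ^ q⁻¹ * ∫⁻ t, ‖K x t‖ₑ * ((w t ^ q⁻¹)⁻¹ * f t ^ p) ∂μ := by
  have hp := hpq.pos
  have hq := hpq.symm.pos
  have hKx : Measurable fun t => ‖K x t‖ₑ := (h.meas.comp measurable_prodMk_left).enorm
  have key := ENNReal.lintegral_mul_le_Lp_mul_Lq μ hpq.symm
    (f := fun t => (‖K x t‖ₑ * w t ^ p⁻¹) ^ q⁻¹)
    (g := fun t => (‖K x t‖ₑ * ((w t ^ q⁻¹)⁻¹ * f t ^ p)) ^ p⁻¹)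
    (by fun_prop) (by fun_prop)
  have hprod : ∀ t, ((fun t => (‖K x t‖ₑ * w t ^ p⁻¹) ^ q⁻¹) *
      (fun t => (‖K x t‖ₑ * ((w t ^ q⁻¹)⁻¹ * f t ^ p)) ^ p⁻¹)) t = ‖K x t‖ₑ * f t := by
    intro t
    simp only [Pi.mul_apply]
    have e0 : (w t ^ (p⁻¹ * q⁻¹)) ≠ 0 := by
      simp [ENNReal.rpow_eq_zero_iff, hw0, hwt]
    have e1 : (w t ^ (p⁻¹ * q⁻¹)) ≠ ⊤ := by
      simp [ENNReal.rpow_eq_top_iff, hw0, hwt]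
    rw [ENNReal.mul_rpow_of_nonneg _ _ (by positivity), ENNReal.mul_rpow_of_nonneg _ _ (by positivity),
      ENNReal.mul_rpow_of_nonneg _ _ (by positivity), ENNReal.inv_rpow, ← ENNReal.rpow_mul,
      ← ENNReal.rpow_mul, ← ENNReal.rpow_mul, mul_inv_cancel₀ hp.ne', ENNReal.rpow_one,
      mul_comm q⁻¹ p⁻¹]
    calc _ = (‖K x t‖ₑ ^ q⁻¹ * ‖K x t‖ₑ ^ p⁻¹) * (w t ^ (p⁻¹ * q⁻¹) * (w t ^ (p⁻¹ * q⁻¹))⁻¹) * f t := by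
          ring
      _ = _ := by
          rw [ENNReal.mul_inv_cancel e0 e1, ← ENNReal.rpow_add_of_nonneg _ _ (by positivity) (by positivity),
            hpq.symm.inv_add_inv_eq_one, ENNReal.rpow_one, mul_one]
  rw [lintegral_congr hprod] at key
  simp only [ENNReal.rpow_inv_rpow hp.ne', ENNReal.rpow_inv_rpow hq.ne', one_div] at key
  calc (∫⁻ t, ‖K x t‖ₑ * f t ∂μ) ^ p
      ≤ ((∫⁻ t, ‖K x t‖ₑ * w t ^ p⁻¹ ∂μ) ^ q⁻¹ *
          (∫⁻ t, ‖K x t‖ₑ * ((w t ^ q⁻¹)⁻¹ * f t ^ p) ∂μ) ^ p⁻¹) ^ p :=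
        ENNReal.rpow_le_rpow key hp.le
    _ ≤ ((C * w x ^ p⁻¹) ^ q⁻¹ *
          (∫⁻ t, ‖K x t‖ₑ * ((w t ^ q⁻¹)⁻¹ * f t ^ p) ∂μ) ^ p⁻¹) ^ p := by
        gcongr
        exact h.left x
    _ = _ := by
        rw [ENNReal.mul_rpow_of_nonneg _ _ hp.le, ENNReal.rpow_inv_rpow hp.ne',
          ← ENNReal.rpow_mul, show q⁻¹ * p = p / q by field_simp,
          ENNReal.mul_rpow_of_nonneg _ _ (by positivity), ← ENNReal.rpow_mul,
          show p⁻¹ * (p / q) = q⁻¹ by field_simp]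

/-- **Schur's test**, in terms of lower Lebesgue integrals. -/
theorem SchurBound.lintegral_rpow_le [SFinite μ] (h : SchurBound μ p q w C K)
    (hpq : p.HolderConjugate q)
    (hw : Measurable w) (hw0 : ∀ x, w x ≠ 0) (hwt : ∀ x, w x ≠ ⊤)
    {f : α → ℝ≥0∞} (hf : Measurable f) :
    ∫⁻ x, (∫⁻ t, ‖K x t‖ₑ * f t ∂μ) ^ p ∂μ ≤ C ^ p * ∫⁻ t, f t ^ p ∂μ := by
  have hp := hpq.pos
  have hq := hpq.symm.pos
  have hK : Measurable fun z : α × α => ‖K z.1 z.2‖ₑ := h.meas.enorm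
  calc ∫⁻ x, (∫⁻ t, ‖K x t‖ₑ * f t ∂μ) ^ p ∂μ
      ≤ ∫⁻ x, C ^ (p / q) * w x ^ q⁻¹ * ∫⁻ t, ‖K x t‖ₑ * ((w t ^ q⁻¹)⁻¹ * f t ^ p) ∂μ ∂μ :=
        lintegral_mono fun x => h.lintegral_rpow_le_apply hpq hw hw0 hwt hf x
    _ = ∫⁻ x, ∫⁻ t, C ^ (p / q) * ((w t ^ q⁻¹)⁻¹ * f t ^ p) * (‖K x t‖ₑ * w x ^ q⁻¹) ∂μ ∂μ := by
        refine lintegral_congr fun x => ?_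
        have hKx : Measurable fun t => ‖K x t‖ₑ := (h.meas.comp measurable_prodMk_left).enorm
        rw [← lintegral_const_mul _ (by fun_prop)]
        refine lintegral_congr fun t => ?_
        ring
    _ = ∫⁻ t, ∫⁻ x, C ^ (p / q) * ((w t ^ q⁻¹)⁻¹ * f t ^ p) * (‖K x t‖ₑ * w x ^ q⁻¹) ∂μ ∂μ := by
        apply lintegral_lintegral_swap
        unfold Function.uncurry
        fun_prop
    _ ≤ ∫⁻ t, C ^ p * f t ^ p ∂μ := by
        refine lintegral_mono fun t => ?_
        have hKt : Measurable fun x => ‖K x t‖ₑ := (h.meas.comp measurable_prodMk_right).enorm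
        rw [lintegral_const_mul _ (by fun_prop)]
        have e0 : w t ^ q⁻¹ ≠ 0 := by simp [ENNReal.rpow_eq_zero_iff, hw0, hwt]
        have e1 : w t ^ q⁻¹ ≠ ⊤ := by simp [ENNReal.rpow_eq_top_iff, hw0, hwt]
        calc _ ≤ C ^ (p / q) * ((w t ^ q⁻¹)⁻¹ * f t ^ p) * (C * w t ^ q⁻¹) := by
              gcongr
              exact h.right t
          _ = (C ^ (p / q) * C ^ (1 : ℝ)) * f t ^ p * (w t ^ q⁻¹ * (w t ^ q⁻¹)⁻¹) := by
              rw [ENNReal.rpow_one]; ring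
          _ = _ := by
              rw [ENNReal.mul_inv_cancel e0 e1, mul_one,
                ← ENNReal.rpow_add_of_nonneg _ _ (by positivity) (by positivity)]
              congr 2
              rw [hpq.div_conj_eq_sub_one, sub_add_cancel]
    _ = _ := lintegral_const_mul _ (by fun_prop)

end Schur

section IntegralOperator

variable {α : Type*} [MeasurableSpace α] {μ : Measure α} {p : ℝ≥0∞} [Fact (1 ≤ p)]
  {q : ℝ} {w : α → ℝ≥0∞} {C : ℝ≥0∞} {K K₁ K₂ : α → α → ℝ}

/-- The bounded operator `T` on `L_p` is the integral operator with kernel `K`. -/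
def IsIntegralOp (K : α → α → ℝ) (T : Lp ℝ p μ →L[ℝ] Lp ℝ p μ) : Prop :=
  ∀ f : Lp ℝ p μ, (T f : α → ℝ) =ᵐ[μ] fun x => ∫ t, K x t * (f : α → ℝ) t ∂μ

theorem SchurBound.eLpNorm_lintegral_le [SFinite μ] (h : SchurBound μ p.toReal q w C K) (hp : p ≠ ⊤)
    (hpq : p.toReal.HolderConjugate q) (hw : Measurable w) (hw0 : ∀ x, w x ≠ 0)
    (hwt : ∀ x, w x ≠ ⊤) (f : Lp ℝ p μ) :
    eLpNorm (fun x => ∫⁻ t, ‖K x t * (f : α → ℝ) t‖ₑ ∂μ) p μ ≤ C * eLpNorm f p μ := by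
  have hp0 : p ≠ 0 := (zero_lt_one.trans_le Fact.out).ne'
  have hf : Measurable fun t => ‖(f : α → ℝ) t‖ₑ := (Lp.stronglyMeasurable f).measurable.enorm
  have key := h.lintegral_rpow_le hpq hw hw0 hwt hf
  rw [eLpNorm_eq_lintegral_rpow_enorm_toReal hp0 hp, eLpNorm_eq_lintegral_rpow_enorm_toReal hp0 hp,
    one_div]
  simp only [enorm_eq_self, enorm_mul]
  calc _ ≤ (C ^ p.toReal * ∫⁻ t, ‖(f : α → ℝ) t‖ₑ ^ p.toReal ∂μ) ^ p.toReal⁻¹ :=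
        ENNReal.rpow_le_rpow key (inv_nonneg.2 hpq.pos.le)
    _ = _ := by
        rw [ENNReal.mul_rpow_of_nonneg _ _ (inv_nonneg.2 hpq.pos.le),
          ENNReal.rpow_rpow_inv hpq.pos.ne']

theorem SchurBound.ae_integrable [SFinite μ] (h : SchurBound μ p.toReal q w C K) (hp : p ≠ ⊤)
    (hpq : p.toReal.HolderConjugate q) (hw : Measurable w) (hw0 : ∀ x, w x ≠ 0)
    (hwt : ∀ x, w x ≠ ⊤) (hC : C ≠ ⊤) (f : Lp ℝ p μ) :
    ∀ᵐ x ∂μ, Integrable (fun t => K x t * (f : α → ℝ) t) μ := by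
  have hp0 : p ≠ 0 := (zero_lt_one.trans_le Fact.out).ne'
  have hf : Measurable (f : α → ℝ) := (Lp.stronglyMeasurable f).measurable
  have hKf : Measurable fun z : α × α => ‖K z.1 z.2 * (f : α → ℝ) z.2‖ₑ :=
    (h.meas.mul (hf.comp measurable_snd)).enorm
  have key := (h.eLpNorm_lintegral_le hp hpq hw hw0 hwt f).trans_lt
    (ENNReal.mul_lt_top hC.lt_top (Lp.eLpNorm_lt_top f))
  have := ae_lt_top' (by fun_prop)
    (lintegral_rpow_enorm_lt_top_of_eLpNorm_lt_top hp0 hp key).ne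
  filter_upwards [this] with x hx
  refine ⟨((h.meas.comp measurable_prodMk_left).mul hf).aestronglyMeasurable, ?_⟩
  rw [enorm_eq_self, ENNReal.rpow_lt_top_iff_of_pos hpq.pos] at hx
  exact hx

/-- **Schur's test**: a kernel with a finite Schur bound `C` defines an integral operator on `L_p`
of norm at most `C`. -/
theorem SchurBound.exists_isIntegralOp [SFinite μ] {C : NNReal}
    (h : SchurBound μ p.toReal q w C K) (hp : p ≠ ⊤)
    (hpq : p.toReal.HolderConjugate q) (hw : Measurable w) (hw0 : ∀ x, w x ≠ 0)
    (hwt : ∀ x, w x ≠ ⊤) :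
    ∃ T : Lp ℝ p μ →L[ℝ] Lp ℝ p μ, ‖T‖ ≤ C ∧ IsIntegralOp K T := by
  have hC : (C : ℝ≥0∞) ≠ ⊤ := ENNReal.coe_ne_top
  let A : Lp ℝ p μ → α → ℝ := fun f x => ∫ t, K x t * (f : α → ℝ) t ∂μ
  have hA : ∀ f, eLpNorm (A f) p μ ≤ C * eLpNorm f p μ := fun f =>
    (eLpNorm_mono_enorm fun x => by
      simpa using enorm_integral_le_lintegral_enorm (μ := μ)
        (fun t => K x t * (f : α → ℝ) t)).trans
      (h.eLpNorm_lintegral_le hp hpq hw hw0 hwt f)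
  have hmeas : ∀ f, AEStronglyMeasurable (A f) μ := fun f =>
    (StronglyMeasurable.integral_prod_right (f := fun x t => K x t * (f : α → ℝ) t)
      (h.meas.mul ((Lp.stronglyMeasurable f).measurable.comp
        measurable_snd)).stronglyMeasurable).aestronglyMeasurable
  have hmem : ∀ f, MemLp (A f) p μ := fun f =>
    ⟨hmeas f, (hA f).trans_lt (ENNReal.mul_lt_top hC.lt_top (Lp.eLpNorm_lt_top f))⟩
  let L : Lp ℝ p μ →ₗ[ℝ] Lp ℝ p μ :=
    { toFun := fun f => (hmem f).toLp
      map_add' := fun f g => by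
        rw [← MemLp.toLp_add, MemLp.toLp_eq_toLp_iff]
        filter_upwards [h.ae_integrable hp hpq hw hw0 hwt hC f,
          h.ae_integrable hp hpq hw hw0 hwt hC g] with x hf hg
        simp only [A, Pi.add_apply]
        rw [← integral_add hf hg]
        refine integral_congr_ae ?_
        filter_upwards [Lp.coeFn_add f g] with t ht
        rw [ht, Pi.add_apply, mul_add]
      map_smul' := fun c f => by
        rw [RingHom.id_apply, ← MemLp.toLp_const_smul, MemLp.toLp_eq_toLp_iff]
        refine .of_forall fun x => ?_
        simp only [A, Pi.smul_apply, smul_eq_mul]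
        rw [← integral_const_mul]
        refine integral_congr_ae ?_
        filter_upwards [Lp.coeFn_smul c f] with t ht
        rw [ht, Pi.smul_apply, smul_eq_mul]
        ring }
  refine ⟨L.mkContinuous C fun f => ?_, L.mkContinuous_norm_le C.2 _, fun f => ?_⟩
  · change ‖(hmem f).toLp‖ ≤ _
    rw [Lp.norm_toLp, Lp.norm_def]
    have := ENNReal.toReal_mono (ENNReal.mul_ne_top hC (Lp.eLpNorm_lt_top f).ne) (hA f)
    simpa using this
  · exact (hmem f).coeFn_toLp

theorem IsIntegralOp.eq_add {T T₁ T₂ : Lp ℝ p μ →L[ℝ] Lp ℝ p μ} (hT : IsIntegralOp K T)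
    (hT₁ : IsIntegralOp K₁ T₁) (hT₂ : IsIntegralOp K₂ T₂) (hK : ∀ x t, K x t = K₁ x t + K₂ x t)
    (h₁ : ∀ f : Lp ℝ p μ, ∀ᵐ x ∂μ, Integrable (fun t => K₁ x t * (f : α → ℝ) t) μ)
    (h₂ : ∀ f : Lp ℝ p μ, ∀ᵐ x ∂μ, Integrable (fun t => K₂ x t * (f : α → ℝ) t) μ) :
    T = T₁ + T₂ := by
  ext1 f
  refine Lp.ext ?_
  filter_upwards [hT f, hT₁ f, hT₂ f, h₁ f, h₂ f, Lp.coeFn_add (T₁ f) (T₂ f)]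
    with x h h1 h2 i1 i2 ha
  rw [add_apply, ha, Pi.add_apply, h, h1, h2, ← integral_add i1 i2]
  simp only [hK, add_mul]

/-- A bounded integral operator whose kernel has the form `a x * g (β x) t`, with `β` taking only
finitely many values, is compact. -/
theorem IsIntegralOp.isCompactOperator_of_finite {ι : Type*} {T : Lp ℝ p μ →L[ℝ] Lp ℝ p μ}
    {β : α → ι} {a : α → ℝ} {g : ι → α → ℝ} {s : Finset ι}
    [MeasurableSpace ι] [MeasurableSingletonClass ι] (hβ : Measurable β) (hs : ∀ x, β x ∈ s)
    (ha : Measurable a) (hT : IsIntegralOp (fun x t => a x * g (β x) t) T) :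
    IsCompactOperator T := by
  classical
  let e : ι → α →ₘ[μ] ℝ := fun k =>
    AEEqFun.mk ((β ⁻¹' {k}).indicator a)
      (ha.indicator (hβ (measurableSet_singleton k))).aestronglyMeasurable
  let V : Submodule ℝ (α →ₘ[μ] ℝ) := Submodule.span ℝ (s.image e : Finset _)
  have hV : FiniteDimensional ℝ V := FiniteDimensional.span_finset ℝ _
  let j : Lp ℝ p μ →ₗ[ℝ] (α →ₘ[μ] ℝ) := (Lp.LpSubmodule ℝ ℝ p μ).subtype
  have hrange : ∀ f, j (T f) ∈ V := by
    intro f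
    have : j (T f) = ∑ k ∈ s, (∫ t, g k t * (f : α → ℝ) t ∂μ) • e k := by
      have hsum : ∀ s' : Finset ι,
          (∑ k ∈ s', (∫ t, g k t * (f : α → ℝ) t ∂μ) • e k : α →ₘ[μ] ℝ) =ᵐ[μ]
            fun x => ∑ k ∈ s', (∫ t, g k t * (f : α → ℝ) t ∂μ) * (β ⁻¹' {k}).indicator a x := by
        intro s'
        induction s' using Finset.induction_on with
        | empty => simpa using! AEEqFun.coeFn_zero
        | insert k s' hk ih =>
          rw [Finset.sum_insert hk]
          filter_upwards [ih, AEEqFun.coeFn_add ((∫ t, g k t * (f : α → ℝ) t ∂μ) • e k)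
            (∑ k ∈ s', (∫ t, g k t * (f : α → ℝ) t ∂μ) • e k),
            AEEqFun.coeFn_smul (∫ t, g k t * (f : α → ℝ) t ∂μ) (e k),
            AEEqFun.coeFn_mk ((β ⁻¹' {k}).indicator a)
              (ha.indicator (hβ (measurableSet_singleton k))).aestronglyMeasurable]
            with x h1 h2 h3 h4
          rw [h2, Pi.add_apply, h1, h3, Pi.smul_apply, h4, Finset.sum_insert hk, smul_eq_mul]
      refine AEEqFun.ext ?_
      filter_upwards [hT f, hsum s] with x h1 h2
      rw [h2]
      refine h1.trans ?_
      rw [Finset.sum_eq_single_of_mem (β x) (hs x) (fun k _ hk => ?_)]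
      · simp only [mul_assoc, integral_const_mul]
        rw [Set.indicator_of_mem (by simp), mul_comm]
      · rw [Set.indicator_of_notMem (by simpa using hk.symm), mul_zero]
    rw [this]
    exact Submodule.sum_mem _ fun k hk => Submodule.smul_mem _ _
      (Submodule.subset_span (by simpa using ⟨k, hk, rfl⟩))
  let R := LinearMap.range (T : Lp ℝ p μ →ₗ[ℝ] Lp ℝ p μ)
  have hR : FiniteDimensional ℝ R := by
    let i : R →ₗ[ℝ] V := (j.comp R.subtype).codRestrict V (by
      rintro ⟨_, f, rfl⟩
      exact hrange f)
    refine FiniteDimensional.of_injective i fun y z hyz => ?_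
    have : (i y : α →ₘ[μ] ℝ) = i z := by rw [hyz]
    exact Subtype.ext (Subtype.ext this)
  have := isCompactOperator_of_locallyCompactSpace_rng R.subtypeL
  exact this.comp_clm (T.codRestrict R fun f => ⟨f, rfl⟩)

end IntegralOperator

section GreenKernel

variable {u v : ℝ → ℝ}

theorem greenKernel_comm (u v : ℝ → ℝ) (x t : ℝ) : greenKernel u v x t = greenKernel u v t x := by
  unfold greenKernel
  rcases lt_trichotomy x t with h | rfl | h
  · rw [if_neg h.not_ge, if_pos h.le]
  · rfl
  · rw [if_pos h.le, if_neg h.not_ge]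

theorem measurable_uncurry_greenKernel (hu : Measurable u) (hv : Measurable v) :
    Measurable (Function.uncurry (greenKernel u v)) := by
  unfold greenKernel Function.uncurry
  exact Measurable.ite (measurableSet_le measurable_snd measurable_fst)
    ((hu.comp measurable_fst).mul (hv.comp measurable_snd))
    ((hu.comp measurable_snd).mul (hv.comp measurable_fst))

/-- If the Green kernel, restricted to the diagonal blocks of suitable finite partitions of the line
into intervals, has arbitrarily small Schur bounds, then the Green operator is compact. -/
theorem exists_isGreenOp_isCompactOperator {p : ℝ≥0∞} [Fact (1 ≤ p)] (hp : p ≠ ⊤) {q : ℝ}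
    (hpq : p.toReal.HolderConjugate q) {w : ℝ → ℝ≥0∞} (hw : Measurable w) (hw0 : ∀ x, w x ≠ 0)
    (hwt : ∀ x, w x ≠ ⊤) (hu : Measurable u) (hv : Measurable v) {C : NNReal}
    (hG : SchurBound volume p.toReal q w C (greenKernel u v))
    (hblock : ∀ ε : NNReal, 0 < ε → ∃ β : ℝ → ℤ, Monotone β ∧ (∃ s : Finset ℤ, ∀ x, β x ∈ s) ∧
      SchurBound volume p.toReal q w ε
        (fun x t => if β x = β t then greenKernel u v x t else 0)) :
    ∃ G : LpR p →L[ℝ] LpR p, IsGreenOp u v p G ∧ IsCompactOperator G := by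
  obtain ⟨G, -, hGint⟩ := hG.exists_isIntegralOp hp hpq hw hw0 hwt
  refine ⟨G, hGint, ?_⟩
  have hcl := isClosed_setOfPred_isCompactOperator (σ₁₂ := RingHom.id ℝ) (M₁ := LpR p) (M₂ := LpR p)
  suffices h : G ∈ closure {f : LpR p →L[ℝ] LpR p | IsCompactOperator f} by
    rw [hcl.closure_eq] at h
    exact h
  refine Metric.mem_closure_iff.2 fun ε hε => ?_
  obtain ⟨β, hβmono, ⟨s, hs⟩, hdiag⟩ := hblock ⟨ε / 2, by positivity⟩ (by
    change (0 : ℝ) < ε / 2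
    positivity)
  have hβ : Measurable β := hβmono.measurable
  have hGm := measurable_uncurry_greenKernel hu hv
  have hbelow : Measurable (Function.uncurry fun x t => u x * (if β t < β x then v t else 0)) := by
    unfold Function.uncurry
    exact (hu.comp measurable_fst).mul (Measurable.ite
      (measurableSet_lt (hβ.comp measurable_snd) (hβ.comp measurable_fst))
      (hv.comp measurable_snd) measurable_const)
  have habove : Measurable (Function.uncurry fun x t => v x * (if β x < β t then u t else 0)) := by
    unfold Function.uncurry
    exact (hv.comp measurable_fst).mul (Measurable.ite
      (measurableSet_lt (hβ.comp measurable_fst) (hβ.comp measurable_snd))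
      (hu.comp measurable_snd) measurable_const)
  have hlt : ∀ {x t}, β t < β x → t < x := fun h => hβmono.reflect_lt h
  have hoff : Measurable (Function.uncurry fun x t =>
      u x * (if β t < β x then v t else 0) + v x * (if β x < β t then u t else 0)) :=
    hbelow.add habove
  have h₁ := hG.mono hbelow fun x t => by
    split_ifs with h
    · simp [greenKernel, (hlt h).le]
    · simp
  have h₂ := hG.mono habove fun x t => by
    split_ifs with h
    · simp [greenKernel, (hlt h).not_ge, mul_comm]
    · simp
  have h₃ := hG.mono hoff fun x t => by
    rcases lt_trichotomy (β x) (β t) with h | h | h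
    · simp [greenKernel, (hlt h).not_ge, mul_comm, h, h.not_gt]
    · simp [h]
    · simp [greenKernel, (hlt h).le, h, h.not_gt]
  obtain ⟨D, hDnorm, hD⟩ := hdiag.exists_isIntegralOp hp hpq hw hw0 hwt
  obtain ⟨T₁, -, hT₁⟩ := h₁.exists_isIntegralOp hp hpq hw hw0 hwt
  obtain ⟨T₂, -, hT₂⟩ := h₂.exists_isIntegralOp hp hpq hw hw0 hwt
  obtain ⟨T₃, -, hT₃⟩ := h₃.exists_isIntegralOp hp hpq hw hw0 hwt
  have i₁ := h₁.ae_integrable hp hpq hw hw0 hwt ENNReal.coe_ne_top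
  have i₂ := h₂.ae_integrable hp hpq hw hw0 hwt ENNReal.coe_ne_top
  have i₃ := h₃.ae_integrable hp hpq hw hw0 hwt ENNReal.coe_ne_top
  have iD := hdiag.ae_integrable hp hpq hw hw0 hwt ENNReal.coe_ne_top
  have e₃ : T₃ = T₁ + T₂ := hT₃.eq_add hT₁ hT₂ (fun _ _ => rfl) i₁ i₂
  have eG : G = D + T₃ := IsIntegralOp.eq_add hGint hD hT₃ (fun x t => by
    rcases lt_trichotomy (β x) (β t) with h | h | h
    · simp [greenKernel, (hlt h).not_ge, mul_comm, h, h.not_gt, h.ne]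
    · simp [h]
    · simp [greenKernel, (hlt h).le, h, h.not_gt, h.ne']) iD i₃
  refine ⟨T₃, ?_, ?_⟩
  · change IsCompactOperator T₃
    rw [e₃]
    exact (hT₁.isCompactOperator_of_finite (g := fun k t => if β t < k then v t else 0) hβ hs hu).add
      (hT₂.isCompactOperator_of_finite (g := fun k t => if k < β t then u t else 0) hβ hs hv)
  · rw [dist_eq_norm, eG, add_sub_cancel_right]
    refine hDnorm.trans_lt ?_
    change ε / 2 < ε
    linarith

/-- The line splits into two half-lines and finitely many short intervals. -/
theorem exists_monotone_block_index {N δ : ℝ} (hN : 0 < N) (hδ : 0 < δ) :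
    ∃ β : ℝ → ℤ, Monotone β ∧ (∃ s : Finset ℤ, ∀ x, β x ∈ s) ∧ ∀ k : ℤ,
      β ⁻¹' {k} ⊆ Set.Ici N ∨ β ⁻¹' {k} ⊆ Set.Iic (-N) ∨
        (β ⁻¹' {k} ⊆ Set.Icc (-N) N ∧ ∀ x ∈ β ⁻¹' {k}, ∀ y ∈ β ⁻¹' {k}, |x - y| ≤ δ) := by
  obtain ⟨n, hn⟩ := exists_nat_gt (N / δ)
  have hn0 : (0 : ℝ) < n := (div_pos hN hδ).trans hn
  have hnZ : (0 : ℤ) < n := by exact_mod_cast hn0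
  refine ⟨fun x => max (-n - 1) (min n ⌊x / N * n⌋), ?_, ⟨Finset.Icc (-n - 1) n, fun x => ?_⟩,
    fun k => ?_⟩
  · intro x y hxy
    dsimp only
    gcongr
  · rw [Finset.mem_Icc]
    dsimp only
    omega
  · simp only [Set.subset_def, Set.mem_preimage, Set.mem_singleton_iff, Set.mem_Ici, Set.mem_Iic,
      Set.mem_Icc]
    by_cases h1 : (n : ℤ) ≤ k
    · left
      intro x hx
      have : (n : ℤ) ≤ ⌊x / N * n⌋ := by omega
      rw [Int.le_floor, Int.cast_natCast, le_mul_iff_one_le_left hn0, le_div_iff₀ hN] at this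
      linarith
    by_cases h2 : k < -n
    · right; left
      intro x hx
      have : ⌊x / N * n⌋ < -n := by omega
      rw [Int.floor_lt] at this
      push_cast at this
      have h3 : x / N < -1 := by
        by_contra! h
        nlinarith
      rw [div_lt_iff₀ hN] at h3
      linarith
    · right; right
      have key : ∀ x, max (-(n : ℤ) - 1) (min (n : ℤ) ⌊x / N * n⌋) = k →
          (k : ℝ) * (N / n) ≤ x ∧ x < (k + 1) * (N / n) := by
        intro x hx
        have : ⌊x / N * n⌋ = k := by omega
        rw [Int.floor_eq_iff] at this
        have e : x = x / N * n * (N / n) := by field_simp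
        constructor
        · rw [e]; gcongr; exact this.1
        · rw [e]; gcongr; exact this.2
      have hNn : N / n ≤ δ := by
        rw [div_le_iff₀ hn0, mul_comm, ← div_le_iff₀ hδ]
        exact hn.le
      have hNn0 : 0 < N / n := by positivity
      have eN : N = n * (N / n) := by field_simp
      refine ⟨fun x hx => ?_, fun x hx y hy => ?_⟩
      · obtain ⟨h3, h4⟩ := key x hx
        have h5 : (-n : ℝ) ≤ k := by exact_mod_cast not_lt.1 h2
        have h6 : (k : ℝ) + 1 ≤ n := by exact_mod_cast not_le.1 h1
        constructor
        · nlinarith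
        · nlinarith
      · obtain ⟨h3, h4⟩ := key x hx
        obtain ⟨h5, h6⟩ := key y hy
        rw [abs_le]
        constructor <;> linarith

end GreenKernel

section Criterion

/-- The Schur bound `ε` for the Green kernel restricted to `S × S`, with weight `W ^ b`. -/
def BlockBound (u v W : ℝ → ℝ) (b : ℝ) (ε : ℝ≥0∞) (S : Set ℝ) : Prop :=
  ∀ x ∈ S, ∫⁻ t in S, ‖greenKernel u v x t‖ₑ * ENNReal.ofReal (W t) ^ b ≤
    ε * ENNReal.ofReal (W x) ^ b

variable {u v W κ : ℝ → ℝ} {b : ℝ} {ε ε' : ℝ≥0∞} {S S' : Set ℝ}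

theorem BlockBound.mono (h : BlockBound u v W b ε S) (hS : S' ⊆ S) (hε : ε ≤ ε') :
    BlockBound u v W b ε' S' := fun x hx =>
  (lintegral_mono_set hS).trans ((h x (hS hx)).trans (mul_le_mul_left hε _))

/-- Short blocks inside a compact interval have small Schur bounds. -/
theorem exists_blockBound_of_short (hu : Continuous u) (hv : Continuous v) (hW : Continuous W)
    (hWpos : ∀ x, 0 < W x) (b : ℝ) (N : ℝ) {ε : NNReal} (hε : 0 < ε) :
    ∃ δ > 0, ∀ S ⊆ Set.Icc (-N) N, (∀ x ∈ S, ∀ y ∈ S, |x - y| ≤ δ) → BlockBound u v W b ε S := by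
  have hbd : ∀ f : ℝ → ℝ, Continuous f → ∃ A > 0, ∀ x ∈ Set.Icc (-N) N, |f x| ≤ A := by
    intro f hf
    obtain ⟨A, hA⟩ := isCompact_Icc.exists_bound_of_continuousOn (hf.continuousOn (s := Set.Icc (-N) N))
    exact ⟨max A 1, by positivity, fun x hx => (hA x hx).trans (le_max_left _ _)⟩
  have hWb : Continuous fun x => W x ^ b := hW.rpow_const fun x => Or.inl (hWpos x).ne'
  obtain ⟨A, hA, hAu⟩ := hbd u hu
  obtain ⟨B, hB, hBv⟩ := hbd v hv
  obtain ⟨D, hD, hDW⟩ := hbd _ hWb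
  obtain ⟨E, hE, hEW⟩ := hbd _ (hWb.inv₀ fun x => (Real.rpow_pos_of_pos (hWpos x) b).ne')
  have hε' : (0 : ℝ) < ε := hε
  refine ⟨ε / (2 * (A * B * D * E)), by positivity, fun S hSN hS x hx => ?_⟩
  set δ : ℝ := ε / (2 * (A * B * D * E)) with hδ
  have hbound : ∀ t ∈ S, ‖greenKernel u v x t‖ₑ * ENNReal.ofReal (W t) ^ b ≤
      ENNReal.ofReal (A * B * D) := by
    intro t ht
    have h1 : |greenKernel u v x t| ≤ A * B := by
      unfold greenKernel
      split_ifs <;> rw [abs_mul] <;> gcongr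
      exacts [hAu x (hSN hx), hBv t (hSN ht), hAu t (hSN ht), hBv x (hSN hx)]
    rw [ENNReal.ofReal_rpow_of_pos (hWpos t), ← ofReal_norm, ← ENNReal.ofReal_mul (norm_nonneg _)]
    apply ENNReal.ofReal_le_ofReal
    have h2 := (le_abs_self _).trans (hDW t (hSN ht))
    rw [Real.norm_eq_abs]
    have := Real.rpow_nonneg (hWpos t).le b
    gcongr
  have hvol : volume S ≤ ENNReal.ofReal (2 * δ) := by
    calc volume S ≤ volume (Set.Icc (x - δ) (x + δ)) := by
          refine measure_mono fun t ht => ?_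
          have := abs_le.1 (hS x hx t ht)
          constructor <;> linarith [this.1, this.2]
      _ = _ := by rw [Real.volume_Icc]; congr 1; ring
  have hE1 : 1 ≤ E * W x ^ b := by
    have h : (W x ^ b)⁻¹ ≤ E := (le_abs_self _).trans (hEW x (hSN hx))
    have h0 := Real.rpow_pos_of_pos (hWpos x) b
    rwa [inv_le_iff_one_le_mul₀ h0] at h
  calc ∫⁻ t in S, ‖greenKernel u v x t‖ₑ * ENNReal.ofReal (W t) ^ b
      ≤ ENNReal.ofReal (A * B * D) * volume S := 
        (setLIntegral_mono measurable_const hbound).trans_eq (setLIntegral_const _ _)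
    _ ≤ ENNReal.ofReal (A * B * D) * ENNReal.ofReal (2 * δ) := by gcongr
    _ ≤ ENNReal.ofReal (ε * W x ^ b) := by
        rw [← ENNReal.ofReal_mul (by positivity)]
        apply ENNReal.ofReal_le_ofReal
        have e : A * B * D * (2 * δ) = ε / E := by rw [hδ]; field_simp
        rw [e, div_le_iff₀ hE]
        nlinarith
    _ = _ := by
        rw [ENNReal.ofReal_mul ε.coe_nonneg, ENNReal.ofReal_rpow_of_pos (hWpos x), ENNReal.ofReal_coe_nnreal]

theorem schurBound_of_blockBound {p q : ℝ} {β : ℝ → ℤ} (hu : Measurable u) (hv : Measurable v)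
    (hβ : Measurable β) (hp : ∀ k, BlockBound u v W p⁻¹ ε (β ⁻¹' {k}))
    (hq : ∀ k, BlockBound u v W q⁻¹ ε (β ⁻¹' {k})) :
    SchurBound volume p q (fun x => ENNReal.ofReal (W x)) ε
      (fun x t => if β x = β t then greenKernel u v x t else 0) := by
  have aux : ∀ b, (∀ k, BlockBound u v W b ε (β ⁻¹' {k})) → ∀ x,
      ∫⁻ t, ‖if β x = β t then greenKernel u v x t else 0‖ₑ * ENNReal.ofReal (W t) ^ b ≤
        ε * ENNReal.ofReal (W x) ^ b := by
    intro b hb x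
    refine le_trans (le_of_eq ?_) (hb (β x) x rfl)
    rw [← lintegral_indicator (hβ (measurableSet_singleton _))]
    refine lintegral_congr fun t => ?_
    by_cases h : β x = β t
    · rw [if_pos h, Set.indicator_of_mem (by simp [h])]
    · rw [if_neg h, Set.indicator_of_notMem (by simpa using Ne.symm h), enorm_zero, zero_mul]
  refine ⟨?_, aux _ hp, fun t => ?_⟩
  · unfold Function.uncurry
    exact Measurable.ite
      (measurableSet_eq_fun (hβ.comp measurable_fst) (hβ.comp measurable_snd))
      (measurable_uncurry_greenKernel hu hv) measurable_const
  · refine le_trans (le_of_eq (lintegral_congr fun x => ?_)) (aux _ hq t)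
    rw [greenKernel_comm]
    simp only [eq_comm]

/-- If Schur bounds of the Green kernel on intervals are controlled by the supremum of a bounded
function `κ` vanishing at infinity, then the Green operator is compact. -/
theorem exists_isGreenOp_isCompactOperator_of_blockBound {p : ℝ≥0∞} [Fact (1 ≤ p)] (hp1 : 1 < p)
    (hp2 : p ≠ ⊤) (hu : Continuous u) (hv : Continuous v) (hW : Continuous W)
    (hWpos : ∀ x, 0 < W x)
    (hκ : BddAbove (Set.range κ)) (hκ0 : Tendsto κ (cocompact ℝ) (𝓝 0))
    (hblock : ∀ b, 0 < b → b < 1 → ∃ C : NNReal, ∀ (M : NNReal) (S : Set ℝ), S.OrdConnected →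
      (∀ t ∈ S, κ t ≤ M) → BlockBound u v W b (C * M) S) :
    ∃ G : LpR p →L[ℝ] LpR p, IsGreenOp u v p G ∧ IsCompactOperator G := by
  have hp : 1 < p.toReal := by
    rw [← ENNReal.toReal_one]
    exact (ENNReal.toReal_lt_toReal ENNReal.one_ne_top hp2).2 hp1
  obtain ⟨q, hpq⟩ : ∃ q, p.toReal.HolderConjugate q := ⟨_, Real.HolderConjugate.conjExponent hp⟩
  have hpb0 : 0 < p.toReal⁻¹ := inv_pos.2 hpq.pos
  have hqb0 : 0 < q⁻¹ := inv_pos.2 hpq.symm.pos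
  have hsum := hpq.inv_add_inv_eq_one
  obtain ⟨C₁, hC₁⟩ := hblock p.toReal⁻¹ hpb0 (by linarith)
  obtain ⟨C₂, hC₂⟩ := hblock q⁻¹ hqb0 (by linarith)
  obtain ⟨M, hM⟩ := hκ
  have hM' : ∀ t, κ t ≤ M.toNNReal := fun t => (hM ⟨t, rfl⟩).trans (Real.le_coe_toNNReal M)
  refine exists_isGreenOp_isCompactOperator (C := (C₁ + C₂) * M.toNNReal) hp2 hpq
    (w := fun x => ENNReal.ofReal (W x)) hW.measurable.ennreal_ofReal
    (fun x => by simpa using hWpos x) (fun x => ENNReal.ofReal_ne_top) hu.measurable hv.measurable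
    ?_ fun ε hε => ?_
  · have := schurBound_of_blockBound (p := p.toReal) (q := q) (W := W) (β := fun _ => 0)
      (ε := ((C₁ + C₂) * M.toNNReal : NNReal)) hu.measurable hv.measurable measurable_const
      (fun k => ((hC₁ M.toNNReal Set.univ Set.ordConnected_univ fun t _ => hM' t).mono
        (Set.subset_univ _) (by
          push_cast
          gcongr
          exact le_self_add)))
      (fun k => ((hC₂ M.toNNReal Set.univ Set.ordConnected_univ fun t _ => hM' t).mono
        (Set.subset_univ _) (by
          push_cast
          gcongr
          exact le_add_self)))
    simpa using this
  · set η : NNReal := ε / (C₁ + C₂ + 1) with hη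
    have hη0 : 0 < η := by positivity
    have hC₁η : (C₁ * η : ℝ≥0∞) ≤ ε := by
      rw [← ENNReal.coe_mul]
      refine ENNReal.coe_le_coe.2 ?_
      rw [hη, mul_div_left_comm]
      refine mul_le_of_le_one_right' ?_
      rw [div_le_one (by positivity)]
      exact le_trans le_self_add le_self_add
    have hC₂η : (C₂ * η : ℝ≥0∞) ≤ ε := by
      rw [← ENNReal.coe_mul]
      refine ENNReal.coe_le_coe.2 ?_
      rw [hη, mul_div_left_comm]
      refine mul_le_of_le_one_right' ?_
      rw [div_le_one (by positivity)]
      exact le_trans le_add_self le_self_add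
    obtain ⟨N, hN, hκN⟩ : ∃ N > 0, ∀ t, N ≤ |t| → κ t ≤ η := by
      have h := hκ0.eventually_le_const (show (0 : ℝ) < η from hη0)
      rw [← Metric.cobounded_eq_cocompact, ← comap_norm_atTop, eventually_comap] at h
      obtain ⟨N, hN⟩ := eventually_atTop.1 h
      exact ⟨max N 1, by positivity, fun t ht => hN _ ((le_max_left _ _).trans ht) t rfl⟩
    obtain ⟨δ₁, hδ₁, h₁⟩ := exists_blockBound_of_short hu hv hW hWpos p.toReal⁻¹ N hε
    obtain ⟨δ₂, hδ₂, h₂⟩ := exists_blockBound_of_short hu hv hW hWpos q⁻¹ N hε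
    obtain ⟨β, hβ, hfin, hfib⟩ := exists_monotone_block_index hN (lt_min hδ₁ hδ₂)
    refine ⟨β, hβ, hfin, schurBound_of_blockBound hu.measurable hv.measurable hβ.measurable
      (fun k => ?_) fun k => ?_⟩
    · rcases hfib k with h | h | ⟨h, hs⟩
      · exact (hC₁ η _ Set.ordConnected_Ici fun t ht => hκN t (le_trans ht (le_abs_self t))).mono
          h hC₁η
      · exact (hC₁ η _ Set.ordConnected_Iic fun t ht => hκN t
          ((le_neg.1 ht).trans (neg_le_abs t))).mono h hC₁η
      · exact h₁ _ h fun x hx y hy => (hs x hx y hy).trans (min_le_left _ _)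
    · rcases hfib k with h | h | ⟨h, hs⟩
      · exact (hC₂ η _ Set.ordConnected_Ici fun t ht => hκN t (le_trans ht (le_abs_self t))).mono
          h hC₂η
      · exact (hC₂ η _ Set.ordConnected_Iic fun t ht => hκN t
          ((le_neg.1 ht).trans (neg_le_abs t))).mono h hC₂η
      · exact h₂ _ h fun x hx y hy => (hs x hx y hy).trans (min_le_right _ _)

end Criterion

section Calculus

theorem Monotone.lintegral_Iic_deriv_le {F : ℝ → ℝ} (hF : Monotone F) (hF0 : ∀ x, 0 ≤ F x)
    (x : ℝ) : ∫⁻ t in Set.Iic x, ENNReal.ofReal (deriv F t) ≤ ENNReal.ofReal (F x) := by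
  have hU : Set.Iic x = ⋃ n : ℕ, Set.Ioc (x - n) x := by
    ext t
    simp only [Set.mem_Iic, Set.mem_iUnion, Set.mem_Ioc]
    refine ⟨fun h => ?_, fun ⟨_, h⟩ => h.2⟩
    obtain ⟨n, hn⟩ := exists_nat_gt (x - t)
    exact ⟨n, by linarith, h⟩
  have hdir : Directed (· ⊆ ·) fun n : ℕ => Set.Ioc (x - n) x := by
    refine directed_of_isDirected_le fun m n hmn => Set.Ioc_subset_Ioc_left ?_
    have : (m : ℝ) ≤ n := by exact_mod_cast hmn
    linarith
  rw [hU, setLIntegral_iUnion_of_directed _ hdir]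
  refine iSup_le fun n => ?_
  have hn : x - n ≤ x := by linarith [(Nat.cast_nonneg n : (0 : ℝ) ≤ n)]
  have hi := (hF.monotoneOn (Set.uIcc (x - n) x)).intervalIntegrable_deriv
  have hle := (hF.monotoneOn (Set.uIcc (x - n) x)).intervalIntegral_deriv_mem_uIcc
  rw [Set.uIcc_of_le (sub_nonneg.2 (hF hn)), intervalIntegral.integral_of_le hn] at hle
  rw [intervalIntegrable_iff_integrableOn_Ioc_of_le hn] at hi
  rw [← ofReal_integral_eq_lintegral_ofReal hi (ae_of_all _ fun t => hF.deriv_nonneg)]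
  exact ENNReal.ofReal_le_ofReal (hle.2.trans (by linarith [hF0 (x - n)]))

variable {u v u' v' : ℝ → ℝ} {b M : ℝ} {S : Set ℝ}

theorem lintegral_inter_Iic_le (hup : ∀ x, 0 < u x) (hvp : ∀ x, 0 < v x) (hu : Antitone u)
    (hv : Monotone v) (hb0 : 0 < b) (hb1 : b < 1) (hM : 0 ≤ M) (hS : MeasurableSet S)
    (h : ∀ᵐ t, t ∈ S → HasDerivAt u (u' t) t ∧ HasDerivAt v (v' t) t ∧
      (u t * v t) ^ 2 ≤ M * (v' t * u t - u' t * v t)) (x : ℝ) :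
    ∫⁻ t in S ∩ Set.Iic x, ENNReal.ofReal (u t ^ b * v t ^ (b + 1)) ≤
      ENNReal.ofReal (M / min b (1 - b) * (u x ^ (b - 1) * v x ^ b)) := by
  set m := min b (1 - b) with hm
  have hm0 : 0 < m := lt_min hb0 (by linarith)
  set F : ℝ → ℝ := fun t => u t ^ (b - 1) * v t ^ b with hFdef
  have hF : Monotone F := fun s t hst => by
    refine mul_le_mul (Real.rpow_le_rpow_of_nonpos (hup t) (hu hst) (by linarith))
      (Real.rpow_le_rpow (hvp s).le (hv hst) hb0.le) ?_ ?_
    · exact Real.rpow_nonneg (hvp s).le _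
    · exact Real.rpow_nonneg (hup t).le _
  have hF0 : ∀ t, 0 ≤ F t := fun t =>
    mul_nonneg (Real.rpow_nonneg (hup t).le _) (Real.rpow_nonneg (hvp t).le _)
  have key : ∀ᵐ t, t ∈ S → u t ^ b * v t ^ (b + 1) ≤ M / m * deriv F t := by
    filter_upwards [h] with t ht htS
    obtain ⟨h1, h2, h3⟩ := ht htS
    have hu' : u' t ≤ 0 := h1.deriv ▸ hu.deriv_nonpos
    have hv' : 0 ≤ v' t := h2.deriv ▸ hv.deriv_nonneg
    have ha := hup t
    have hc := hvp t
    have hd : deriv F t =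
        u' t * (b - 1) * u t ^ (b - 1 - 1) * v t ^ b +
          u t ^ (b - 1) * (v' t * b * v t ^ (b - 1)) :=
      ((h1.rpow_const (Or.inl ha.ne')).mul (h2.rpow_const (Or.inl hc.ne'))).deriv
    have e1 : u t ^ (b - 1) = u t ^ (b - 2) * u t := by
      rw [← Real.rpow_add_one ha.ne']; congr 1; ring
    have e2 : u t ^ b = u t ^ (b - 2) * u t ^ 2 := by
      rw [← Real.rpow_add_natCast ha.ne']; congr 1; push_cast; ring
    have e3 : v t ^ b = v t ^ (b - 1) * v t := by
      rw [← Real.rpow_add_one hc.ne']; congr 1; ring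
    have e4 : v t ^ (b + 1) = v t ^ (b - 1) * v t ^ 2 := by
      rw [← Real.rpow_add_natCast hc.ne']; congr 1; push_cast; ring
    have e5 : u t ^ (b - 1 - 1) = u t ^ (b - 2) := by congr 1; ring
    have hA := Real.rpow_pos_of_pos ha (b - 2)
    have hB := Real.rpow_pos_of_pos hc (b - 1)
    rw [hd, e5, e1, e2, e3, e4, div_mul_eq_mul_div, le_div_iff₀ hm0]
    have hmb : m ≤ b := min_le_left _ _
    have hmb' : m ≤ 1 - b := min_le_right _ _
    have i1 : m * (v' t * u t) ≤ b * (v' t * u t) := by gcongr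
    have i2 : m * (-u' t * v t) ≤ (1 - b) * (-u' t * v t) := by
      have : 0 ≤ -u' t * v t := mul_nonneg (by linarith) hc.le
      gcongr
    have i3 : m * (u t * v t) ^ 2 ≤ M * (b * (v' t * u t) + (1 - b) * (-u' t * v t)) := by
      calc m * (u t * v t) ^ 2 ≤ m * (M * (v' t * u t - u' t * v t)) := by gcongr
        _ = M * (m * (v' t * u t) + m * (-u' t * v t)) := by ring
        _ ≤ _ := by gcongr
    have i4 := mul_le_mul_of_nonneg_left i3 (mul_pos hA hB).le
    linarith
  have hMm : 0 ≤ M / m := by positivity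
  calc ∫⁻ t in S ∩ Set.Iic x, ENNReal.ofReal (u t ^ b * v t ^ (b + 1))
      ≤ ∫⁻ t in S ∩ Set.Iic x, ENNReal.ofReal (M / m) * ENNReal.ofReal (deriv F t) := by
        refine setLIntegral_mono_ae' (hS.inter measurableSet_Iic) ?_
        filter_upwards [key] with t ht htS
        rw [← ENNReal.ofReal_mul hMm]
        exact ENNReal.ofReal_le_ofReal (ht htS.1)
    _ ≤ ∫⁻ t in Set.Iic x, ENNReal.ofReal (M / m) * ENNReal.ofReal (deriv F t) :=
        lintegral_mono_set Set.inter_subset_right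
    _ = ENNReal.ofReal (M / m) * ∫⁻ t in Set.Iic x, ENNReal.ofReal (deriv F t) :=
        lintegral_const_mul' _ _ ENNReal.ofReal_ne_top
    _ ≤ ENNReal.ofReal (M / m) * ENNReal.ofReal (F x) := by
        gcongr
        exact hF.lintegral_Iic_deriv_le hF0 x
    _ = _ := (ENNReal.ofReal_mul hMm).symm

theorem lintegral_inter_Ici_le (hup : ∀ x, 0 < u x) (hvp : ∀ x, 0 < v x) (hu : Antitone u)
    (hv : Monotone v) (hb0 : 0 < b) (hb1 : b < 1) (hM : 0 ≤ M) (hS : MeasurableSet S)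
    (h : ∀ᵐ t, t ∈ S → HasDerivAt u (u' t) t ∧ HasDerivAt v (v' t) t ∧
      (u t * v t) ^ 2 ≤ M * (v' t * u t - u' t * v t)) (x : ℝ) :
    ∫⁻ t in S ∩ Set.Ici x, ENNReal.ofReal (v t ^ b * u t ^ (b + 1)) ≤
      ENNReal.ofReal (M / min b (1 - b) * (v x ^ (b - 1) * u x ^ b)) := by
  have hneg := Measure.measurePreserving_neg (volume : Measure ℝ)
  have key := lintegral_inter_Iic_le (u := fun t => v (-t)) (v := fun t => u (-t))
    (u' := fun t => -v' (-t)) (v' := fun t => -u' (-t)) (S := Neg.neg ⁻¹' S)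
    (fun t => hvp _) (fun t => hup _) (fun s t hst => hv (neg_le_neg hst))
    (fun s t hst => hu (neg_le_neg hst)) hb0 hb1 hM (measurable_neg hS) (by
      filter_upwards [hneg.quasiMeasurePreserving.ae h] with t ht htS
      obtain ⟨h1, h2, h3⟩ := ht htS
      refine ⟨?_, ?_, ?_⟩
      · exact mul_neg_one (v' (-t)) ▸ h2.comp t (hasDerivAt_neg t)
      · exact mul_neg_one (u' (-t)) ▸ h1.comp t (hasDerivAt_neg t)
      · calc _ = (u (-t) * v (-t)) ^ 2 := by ring
          _ ≤ _ := h3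
          _ = _ := by ring) (-x)
  simp only [neg_neg] at key
  refine le_trans (le_of_eq ?_) key
  have hpre : Neg.neg ⁻¹' S ∩ Set.Iic (-x) = Neg.neg ⁻¹' (S ∩ Set.Ici x) := by
    ext t
    simp
  rw [hpre, hneg.setLIntegral_comp_preimage_emb (MeasurableEquiv.neg ℝ).measurableEmbedding
    (fun t => ENNReal.ofReal (v t ^ b * u t ^ (b + 1)))]

/-- If `(u v)² ≤ M (v' u - u' v)`, the Green kernel has Schur bound of order `M` with respect to
powers of `u v`. -/
theorem blockBound_mul_of_hasDerivAt (hup : ∀ x, 0 < u x) (hvp : ∀ x, 0 < v x) (hu : Antitone u)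
    (hv : Monotone v) (hb0 : 0 < b) (hb1 : b < 1) (hM : 0 ≤ M) (hS : MeasurableSet S)
    (h : ∀ᵐ t, t ∈ S → HasDerivAt u (u' t) t ∧ HasDerivAt v (v' t) t ∧
      (u t * v t) ^ 2 ≤ M * (v' t * u t - u' t * v t)) :
    BlockBound u v (fun t => u t * v t) b (ENNReal.ofReal (2 / min b (1 - b) * M)) S := by
  intro x _
  have hm0 : 0 < min b (1 - b) := lt_min hb0 (by linarith)
  have hx : 0 < u x * v x := mul_pos (hup x) (hvp x)
  have hle : ∀ t ≤ x, ‖greenKernel u v x t‖ₑ * ENNReal.ofReal (u t * v t) ^ b =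
      ENNReal.ofReal (u x) * ENNReal.ofReal (u t ^ b * v t ^ (b + 1)) := by
    intro t ht
    rw [greenKernel, if_pos ht, ENNReal.ofReal_rpow_of_pos (mul_pos (hup t) (hvp t)),
      Real.enorm_of_nonneg (mul_pos (hup x) (hvp t)).le,
      ← ENNReal.ofReal_mul (mul_pos (hup x) (hvp t)).le, ← ENNReal.ofReal_mul (hup x).le,
      Real.mul_rpow (hup t).le (hvp t).le, Real.rpow_add_one (hvp t).ne']
    congr 1; ring
  have hge : ∀ t, x ≤ t → ‖greenKernel u v x t‖ₑ * ENNReal.ofReal (u t * v t) ^ b =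
      ENNReal.ofReal (v x) * ENNReal.ofReal (v t ^ b * u t ^ (b + 1)) := by
    intro t ht
    rw [greenKernel_comm, greenKernel, if_pos ht,
      ENNReal.ofReal_rpow_of_pos (mul_pos (hup t) (hvp t)),
      Real.enorm_of_nonneg (mul_pos (hup t) (hvp x)).le,
      ← ENNReal.ofReal_mul (mul_pos (hup t) (hvp x)).le, ← ENNReal.ofReal_mul (hvp x).le,
      Real.mul_rpow (hup t).le (hvp t).le, Real.rpow_add_one (hup t).ne']
    congr 1; ring
  have hsub : S ⊆ (S ∩ Set.Iic x) ∪ (S ∩ Set.Ici x) := fun t ht =>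
    (le_total t x).imp (fun h => ⟨ht, h⟩) fun h => ⟨ht, h⟩
  have hMm : 0 ≤ M / min b (1 - b) := by positivity
  have e1 : ∀ a : ℝ, 0 < a → a * a ^ (b - 1) = a ^ b := fun a ha => by
    rw [Real.rpow_sub_one ha.ne']; field_simp
  calc ∫⁻ t in S, ‖greenKernel u v x t‖ₑ * ENNReal.ofReal (u t * v t) ^ b
      ≤ (∫⁻ t in S ∩ Set.Iic x, ‖greenKernel u v x t‖ₑ * ENNReal.ofReal (u t * v t) ^ b) +
          ∫⁻ t in S ∩ Set.Ici x, ‖greenKernel u v x t‖ₑ * ENNReal.ofReal (u t * v t) ^ b :=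
        (lintegral_mono_set hsub).trans (lintegral_union_le _ _ _)
    _ = ENNReal.ofReal (u x) *
            (∫⁻ t in S ∩ Set.Iic x, ENNReal.ofReal (u t ^ b * v t ^ (b + 1))) +
          ENNReal.ofReal (v x) *
            ∫⁻ t in S ∩ Set.Ici x, ENNReal.ofReal (v t ^ b * u t ^ (b + 1)) := by
        rw [← lintegral_const_mul' _ _ ENNReal.ofReal_ne_top,
          ← lintegral_const_mul' _ _ ENNReal.ofReal_ne_top,
          setLIntegral_congr_fun (hS.inter measurableSet_Iic) fun t ht => hle t ht.2,
          setLIntegral_congr_fun (hS.inter measurableSet_Ici) fun t ht => hge t ht.2]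
    _ ≤ ENNReal.ofReal (u x) *
            ENNReal.ofReal (M / min b (1 - b) * (u x ^ (b - 1) * v x ^ b)) +
          ENNReal.ofReal (v x) *
            ENNReal.ofReal (M / min b (1 - b) * (v x ^ (b - 1) * u x ^ b)) := by
        gcongr
        · exact lintegral_inter_Iic_le hup hvp hu hv hb0 hb1 hM hS h x
        · exact lintegral_inter_Ici_le hup hvp hu hv hb0 hb1 hM hS h x
    _ = ENNReal.ofReal (2 / min b (1 - b) * M) * ENNReal.ofReal (u x * v x) ^ b := by
        have hua := Real.rpow_pos_of_pos (hup x) (b - 1)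
        have hub := Real.rpow_pos_of_pos (hup x) b
        have hva := Real.rpow_pos_of_pos (hvp x) (b - 1)
        have hvb := Real.rpow_pos_of_pos (hvp x) b
        have := hup x
        have := hvp x
        rw [ENNReal.ofReal_rpow_of_pos hx, ← ENNReal.ofReal_mul (by positivity),
          ← ENNReal.ofReal_mul (by positivity), ← ENNReal.ofReal_mul (by positivity),
          ← ENNReal.ofReal_add (by positivity) (by positivity),
          Real.mul_rpow (hup x).le (hvp x).le, ← e1 _ (hup x), ← e1 _ (hvp x)]
        congr 1; ring

end Calculus

section PrincipalSystem

theorem ae_hasDerivAt_of_forall_sub_eq {f f' : ℝ → ℝ}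
    (hi : ∀ a b : ℝ, IntervalIntegrable f' volume a b)
    (hf : ∀ a b : ℝ, f b - f a = ∫ t in a..b, f' t) : ∀ᵐ x, HasDerivAt f (f' x) x := by
  have hloc : LocallyIntegrable f' volume := fun x =>
    ⟨Set.Ioo (x - 1) (x + 1), Ioo_mem_nhds (by linarith) (by linarith),
      (hi (x - 1) (x + 1)).1.mono_set Set.Ioo_subset_Ioc_self⟩
  filter_upwards [_root_.LocallyIntegrable.ae_hasDerivAt_integral hloc] with x hx
  have h := (hx 0).add_const (f 0)
  refine h.congr_of_eventuallyEq (Eventually.of_forall fun y => ?_)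
  simp only [← hf 0 y, sub_add_cancel]

theorem continuous_of_forall_sub_eq {f f' : ℝ → ℝ}
    (hi : ∀ a b : ℝ, IntervalIntegrable f' volume a b)
    (hf : ∀ a b : ℝ, f b - f a = ∫ t in a..b, f' t) : Continuous f := by
  have h := (intervalIntegral.continuous_primitive hi 0).add (continuous_const (y := f 0))
  exact h.congr fun x => by simp [← hf 0 x]

theorem MeasureTheory.LocallyIntegrable.intervalIntegrable' {f : ℝ → ℝ}
    (hf : LocallyIntegrable f volume) (a b : ℝ) : IntervalIntegrable f volume a b :=
  intervalIntegrable_iff.2 ((hf.integrableOn_isCompact isCompact_uIcc).mono_set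
    Set.uIoc_subset_uIcc)

variable {r q u v u' v' d₁ d₂ : ℝ → ℝ}

theorem PFSS.continuous_u (h : PFSS r q u v u' v') : Continuous u :=
  continuous_of_forall_sub_eq h.u'_intble h.u_deriv

theorem PFSS.continuous_v (h : PFSS r q u v u' v') : Continuous v :=
  continuous_of_forall_sub_eq h.v'_intble h.v_deriv

theorem PFSS.antitone_u (h : PFSS r q u v u' v') : Antitone u := fun a b hab => by
  have := intervalIntegral.integral_nonneg hab (f := fun t => -u' t) (μ := volume)
    fun t _ => neg_nonneg.2 (h.u'_nonpos t)
  rw [intervalIntegral.integral_neg, ← h.u_deriv] at this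
  linarith

theorem PFSS.monotone_v (h : PFSS r q u v u' v') : Monotone v := fun a b hab => by
  have := intervalIntegral.integral_nonneg hab (f := v') (μ := volume) fun t _ => h.v'_nonneg t
  rw [← h.v_deriv] at this
  linarith

theorem Cond12.phiF_pos (h12 : Cond12 r q) (hd₁ : IsD1 r q d₁) (x : ℝ) : 0 < phiF r d₁ x := by
  obtain ⟨hd, h1⟩ := hd₁ x
  refine lt_of_le_of_ne (intervalIntegral.integral_nonneg (by linarith) fun t _ =>
    (one_div_pos.2 (h12.2.2.1 t)).le) fun h0 => ?_
  rw [phiF] at h0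
  rw [← h0, zero_mul] at h1
  exact zero_ne_one h1

theorem Cond12.psiF_pos (h12 : Cond12 r q) (hd₂ : IsD2 r q d₂) (x : ℝ) : 0 < psiF r d₂ x := by
  obtain ⟨hd, h1⟩ := hd₂ x
  refine lt_of_le_of_ne (intervalIntegral.integral_nonneg (by linarith) fun t _ =>
    (one_div_pos.2 (h12.2.2.1 t)).le) fun h0 => ?_
  rw [psiF] at h0
  rw [← h0, zero_mul] at h1
  exact zero_ne_one h1

theorem PFSS.mul_le_two_mul_phiF (h : PFSS r q u v u' v') (h12 : Cond12 r q) (hd₁ : IsD1 r q d₁)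
    (x : ℝ) : u x * v x ≤ 2 * phiF r d₁ x := by
  have hφ := h12.phiF_pos hd₁ x
  obtain ⟨-, -, hr, hq, hrint, hqint⟩ := h12
  obtain ⟨hd, h1⟩ := hd₁ x
  rw [← phiF] at h1
  set a := x - d₁ x with ha
  have hax : a ≤ x := by linarith
  have hqv : ∀ s t, IntervalIntegrable (fun y => q y * v y) volume s t := fun s t =>
    (hqint.intervalIntegrable' s t).mul_continuousOn h.continuous_v.continuousOn
  have hmono : ∀ t, t ≤ x → r t * v' t ≤ r x * v' x := fun t ht => by
    have := intervalIntegral.integral_nonneg ht (f := fun y => q y * v y) (μ := volume)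
      fun y _ => mul_nonneg (hq y) (h.v_pos y).le
    rw [← h.rv'_deriv] at this
    linarith
  have e1 : v x - v a ≤ r x * v' x * phiF r d₁ x := by
    rw [h.v_deriv, phiF, ← ha, ← intervalIntegral.integral_const_mul]
    refine intervalIntegral.integral_mono_on hax (h.v'_intble _ _)
      ((hrint.intervalIntegrable' _ _).const_mul _) fun t ht => ?_
    rw [mul_one_div, le_div_iff₀ (hr t), mul_comm]
    exact hmono t ht.2
  have e2 : v a * (∫ t in a..x, q t) ≤ r x * v' x := by
    have i1 : ∫ t in a..x, v a * q t ≤ ∫ t in a..x, q t * v t := by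
      refine intervalIntegral.integral_mono_on hax ((hqint.intervalIntegrable' _ _).const_mul _)
        (hqv _ _) fun t ht => ?_
      rw [mul_comm]
      exact mul_le_mul_of_nonneg_left (h.monotone_v ht.1) (hq t)
    rw [intervalIntegral.integral_const_mul, ← h.rv'_deriv] at i1
    linarith [mul_nonneg (hr a).le (h.v'_nonneg a)]
  have e3 : v a ≤ r x * v' x * phiF r d₁ x := by
    calc v a = v a * (∫ t in a..x, q t) * phiF r d₁ x := by rw [mul_assoc, mul_comm _ (phiF _ _ _),
          h1, mul_one]
      _ ≤ _ := by gcongr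
  have e4 : u x * (r x * v' x) ≤ 1 := by
    have hw := h.wronskian x
    have : 0 ≤ r x * (-u' x * v x) :=
      mul_nonneg (hr x).le (mul_nonneg (neg_nonneg.2 (h.u'_nonpos x)) (h.v_pos x).le)
    linarith
  calc u x * v x ≤ u x * (2 * (r x * v' x * phiF r d₁ x)) :=
        mul_le_mul_of_nonneg_left (by linarith) (h.u_pos x).le
    _ = u x * (r x * v' x) * (2 * phiF r d₁ x) := by ring
    _ ≤ 1 * (2 * phiF r d₁ x) := by gcongr
    _ = _ := one_mul _

theorem PFSS.mul_le_two_mul_psiF (h : PFSS r q u v u' v') (h12 : Cond12 r q) (hd₂ : IsD2 r q d₂)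
    (x : ℝ) : u x * v x ≤ 2 * psiF r d₂ x := by
  have hψ := h12.psiF_pos hd₂ x
  obtain ⟨-, -, hr, hq, hrint, hqint⟩ := h12
  obtain ⟨hd, h1⟩ := hd₂ x
  rw [← psiF] at h1
  set a := x + d₂ x with ha
  have hax : x ≤ a := by linarith
  have hqu : ∀ s t, IntervalIntegrable (fun y => q y * u y) volume s t := fun s t =>
    (hqint.intervalIntegrable' s t).mul_continuousOn h.continuous_u.continuousOn
  have hmono : ∀ t, x ≤ t → r x * u' x ≤ r t * u' t := fun t ht => by
    have := intervalIntegral.integral_nonneg ht (f := fun y => q y * u y) (μ := volume)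
      fun y _ => mul_nonneg (hq y) (h.u_pos y).le
    rw [← h.ru'_deriv] at this
    linarith
  have e1 : r x * u' x * psiF r d₂ x ≤ u a - u x := by
    rw [h.u_deriv, psiF, ← ha, ← intervalIntegral.integral_const_mul]
    refine intervalIntegral.integral_mono_on hax ((hrint.intervalIntegrable' _ _).const_mul _)
      (h.u'_intble _ _) fun t ht => ?_
    rw [mul_one_div, div_le_iff₀ (hr t), mul_comm (u' t)]
    exact hmono t ht.1
  have e2 : u a * (∫ t in x..a, q t) ≤ -(r x * u' x) := by
    have i1 : ∫ t in x..a, u a * q t ≤ ∫ t in x..a, q t * u t := by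
      refine intervalIntegral.integral_mono_on hax ((hqint.intervalIntegrable' _ _).const_mul _)
        (hqu _ _) fun t ht => ?_
      rw [mul_comm]
      exact mul_le_mul_of_nonneg_left (h.antitone_u ht.2) (hq t)
    rw [intervalIntegral.integral_const_mul, ← h.ru'_deriv] at i1
    linarith [mul_nonneg (hr a).le (neg_nonneg.2 (h.u'_nonpos a))]
  have e3 : u a ≤ -(r x * u' x) * psiF r d₂ x := by
    calc u a = u a * (∫ t in x..a, q t) * psiF r d₂ x := by rw [mul_assoc, mul_comm _ (psiF _ _ _),
          h1, mul_one]
      _ ≤ _ := by gcongr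
  have e4 : v x * -(r x * u' x) ≤ 1 := by
    have hw := h.wronskian x
    have : 0 ≤ r x * (v' x * u x) :=
      mul_nonneg (hr x).le (mul_nonneg (h.v'_nonneg x) (h.u_pos x).le)
    linarith
  calc u x * v x ≤ 2 * (-(r x * u' x) * psiF r d₂ x) * v x :=
        mul_le_mul_of_nonneg_right (by linarith) (h.v_pos x).le
    _ = v x * -(r x * u' x) * (2 * psiF r d₂ x) := by ring
    _ ≤ 1 * (2 * psiF r d₂ x) := by gcongr
    _ = _ := one_mul _

theorem PFSS.mul_le_four_mul_hF (h : PFSS r q u v u' v') (h12 : Cond12 r q) (hd₁ : IsD1 r q d₁)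
    (hd₂ : IsD2 r q d₂) (x : ℝ) : u x * v x ≤ 4 * hF r d₁ d₂ x := by
  have hφ := h12.phiF_pos hd₁ x
  have hψ := h12.psiF_pos hd₂ x
  have h1 := h.mul_le_two_mul_phiF h12 hd₁ x
  have h2 := h.mul_le_two_mul_psiF h12 hd₂ x
  rw [hF, ← mul_div_assoc, le_div_iff₀ (by positivity)]
  nlinarith

theorem Cond12.hF_sq_le (h12 : Cond12 r q) (hd₁ : IsD1 r q d₁) (hd₂ : IsD2 r q d₂) (x : ℝ) :
    hF r d₁ d₂ x ^ 2 ≤ phiF r d₁ x * psiF r d₂ x := by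
  have hφ := h12.phiF_pos hd₁ x
  have hψ := h12.psiF_pos hd₂ x
  rw [sq]
  have h1 : hF r d₁ d₂ x ≤ phiF r d₁ x := by
    rw [hF, div_le_iff₀ (by positivity)]
    nlinarith
  have h2 : hF r d₁ d₂ x ≤ psiF r d₂ x := by
    rw [hF, div_le_iff₀ (by positivity)]
    nlinarith
  have h0 : 0 ≤ hF r d₁ d₂ x := by unfold hF; positivity
  gcongr

theorem PFSS.blockBound_mul (h : PFSS r q u v u' v') (hr : ∀ x, 0 < r x) {b : ℝ} (hb0 : 0 < b)
    (hb1 : b < 1) (M : NNReal) {S : Set ℝ} (hS : S.OrdConnected)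
    (hM : ∀ t ∈ S, r t * (u t * v t) ^ 2 ≤ M) :
    BlockBound u v (fun t => u t * v t) b ((2 / min b (1 - b)).toNNReal * M) S := by
  have hm0 : 0 < min b (1 - b) := lt_min hb0 (by linarith)
  refine (blockBound_mul_of_hasDerivAt (u' := u') (v' := v') h.u_pos h.v_pos h.antitone_u
    h.monotone_v hb0 hb1 M.coe_nonneg hS.measurableSet ?_).mono subset_rfl (le_of_eq ?_)
  · filter_upwards [ae_hasDerivAt_of_forall_sub_eq h.u'_intble h.u_deriv,
      ae_hasDerivAt_of_forall_sub_eq h.v'_intble h.v_deriv] with t hu hv ht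
    refine ⟨hu, hv, ?_⟩
    have hw : v' t * u t - u' t * v t = (r t)⁻¹ :=
      eq_inv_of_mul_eq_one_right (h.wronskian t)
    rw [hw, ← div_eq_mul_inv, le_div_iff₀ (hr t), mul_comm]
    exact hM t ht
  · rw [ENNReal.ofReal_mul (by positivity), ENNReal.ofReal_coe_nnreal, ENNReal.ofReal]

end PrincipalSystem

section PowerWeight

variable {u v : ℝ → ℝ} {b : ℝ} {S : Set ℝ}

theorem greenKernel_le_left (hu : Antitone u) (hup : ∀ x, 0 < u x) (hv : Monotone v)
    (hvp : ∀ x, 0 < v x) (x t : ℝ) : greenKernel u v x t ≤ u x * v x := by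
  unfold greenKernel
  split_ifs with h
  · exact mul_le_mul_of_nonneg_left (hv h) (hup x).le
  · exact mul_le_mul_of_nonneg_right (hu (le_of_not_ge h)) (hvp x).le

/-- Schur bound on the half line for the kernel `min (1 + x)⁻¹ (1 + t)⁻¹`. -/
theorem blockBound_inv_one_add (hb0 : 0 < b) (hb1 : b < 1) :
    BlockBound (fun t => (1 + max t 0)⁻¹) (fun _ => 1) (fun t => (1 + max t 0)⁻¹) b
      (ENNReal.ofReal (2 / min b (1 - b))) (Set.Ici 0) := by
  have hpos : ∀ t : ℝ, 0 < 1 + max t 0 := fun t => by positivity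
  have := blockBound_mul_of_hasDerivAt (u := fun t => (1 + max t 0)⁻¹) (v := fun _ => 1)
    (u' := fun t => -1 / (1 + t) ^ 2) (v' := fun _ => 0) (M := 1) (S := Set.Ici 0)
    (fun x => inv_pos.2 (hpos x)) (fun _ => one_pos)
    (fun s t hst => inv_anti₀ (hpos s) (by gcongr)) monotone_const hb0 hb1 zero_le_one
    measurableSet_Ici (by
      filter_upwards [volume.ae_ne 0] with t ht0 ht
      have ht' : 0 < t := lt_of_le_of_ne ht ht0.symm
      refine ⟨?_, hasDerivAt_const _ _, ?_⟩
      · have hd : HasDerivAt (fun s : ℝ => (1 + s)⁻¹) (-1 / (1 + t) ^ 2) t :=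
          ((hasDerivAt_id t).const_add 1).inv (by simp; positivity)
        refine hd.congr_of_eventuallyEq ?_
        filter_upwards [lt_mem_nhds ht'] with s hs
        rw [max_eq_left hs.le]
      · rw [max_eq_left ht'.le]
        apply le_of_eq
        field_simp
        ring)
  simpa using this

theorem lintegral_comp_abs_le (f : ℝ → ℝ≥0∞) :
    ∫⁻ t, f |t| ≤ 2 * ∫⁻ t in Set.Ici 0, f t := by
  have hpos : ∫⁻ t in Set.Ici (0 : ℝ), f |t| = ∫⁻ t in Set.Ici 0, f t :=
    setLIntegral_congr_fun measurableSet_Ici fun t ht => by rw [abs_of_nonneg ht]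
  have hneg : ∫⁻ t in Set.Iic (0 : ℝ), f |t| = ∫⁻ t in Set.Ici 0, f t := by
    rw [← hpos, ← (Measure.measurePreserving_neg (volume : Measure ℝ)).setLIntegral_comp_preimage_emb
      (MeasurableEquiv.neg ℝ).measurableEmbedding (fun t => f |t|)]
    simp
  calc ∫⁻ t, f |t| = ∫⁻ t in Set.Ici 0 ∪ Set.Iic 0, f |t| := by
        rw [Set.union_comm, Set.Iic_union_Ici, setLIntegral_univ]
    _ ≤ _ := lintegral_union_le _ _ _
    _ = _ := by rw [hpos, hneg, two_mul]

theorem blockBound_inv_one_add_abs (hu : Antitone u) (hup : ∀ x, 0 < u x) (hv : Monotone v)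
    (hvp : ∀ x, 0 < v x) (hb0 : 0 < b) (hb1 : b < 1) (M : NNReal)
    (hM : ∀ t ∈ S, u t * v t * (1 + |t|) ≤ M) (hS : MeasurableSet S) :
    BlockBound u v (fun t => (1 + |t|)⁻¹) b ((2 * (2 / min b (1 - b)).toNNReal : NNReal) * M) S := by
  intro x hx
  set k : ℝ → ℝ → ℝ := greenKernel (fun t => (1 + max t 0)⁻¹) (fun _ => 1) with hk
  set f : ℝ → ℝ≥0∞ := fun t => ‖k |x| t‖ₑ * ENNReal.ofReal ((1 + max t 0)⁻¹) ^ b with hf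
  have hρ : ∀ t ∈ S, u t * v t ≤ M * (1 + |t|)⁻¹ := fun t ht => by
    rw [← div_eq_mul_inv, le_div_iff₀ (by positivity)]
    exact hM t ht
  have hmax : ∀ t : ℝ, max |t| 0 = |t| := fun t => max_eq_left (abs_nonneg t)
  have hG : ∀ t ∈ S, ‖greenKernel u v x t‖ₑ ≤ M * ‖k |x| |t|‖ₑ := by
    intro t ht
    have h0 : 0 ≤ greenKernel u v x t := by
      unfold greenKernel
      split_ifs
      exacts [(mul_pos (hup _) (hvp _)).le, (mul_pos (hup _) (hvp _)).le]
    have hkt : k |x| |t| = if |t| ≤ |x| then (1 + |x|)⁻¹ else (1 + |t|)⁻¹ := by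
      simp only [hk, greenKernel, mul_one, hmax]
    have hle : greenKernel u v x t ≤ M * k |x| |t| := by
      rw [hkt]
      split_ifs
      · exact (greenKernel_le_left hu hup hv hvp x t).trans (hρ x hx)
      · rw [greenKernel_comm]
        exact (greenKernel_le_left hu hup hv hvp t x).trans (hρ t ht)
    rw [Real.enorm_of_nonneg h0, ← ofReal_norm, ← ENNReal.ofReal_coe_nnreal,
      ← ENNReal.ofReal_mul M.coe_nonneg]
    exact ENNReal.ofReal_le_ofReal (hle.trans (by gcongr; exact le_abs_self _))
  calc ∫⁻ t in S, ‖greenKernel u v x t‖ₑ * ENNReal.ofReal ((1 + |t|)⁻¹) ^ b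
      ≤ ∫⁻ t in S, M * f |t| := by
        refine setLIntegral_mono' hS fun t ht => ?_
        simp only [hf, hmax]
        rw [← mul_assoc]
        gcongr
        exact hG t ht
    _ ≤ M * ∫⁻ t, f |t| := by
        rw [lintegral_const_mul' _ _ ENNReal.coe_ne_top]
        gcongr
        exact Measure.restrict_le_self
    _ ≤ M * (2 * (ENNReal.ofReal (2 / min b (1 - b)) * ENNReal.ofReal ((1 + |x|)⁻¹) ^ b)) := by
        gcongr
        refine (lintegral_comp_abs_le f).trans ?_
        gcongr
        simpa using blockBound_inv_one_add hb0 hb1 |x| (abs_nonneg x)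
    _ = _ := by
        rw [ENNReal.ofReal]
        push_cast
        ring

end PowerWeight

theorem bddAbove_range_of_tendsto_cocompact {κ : ℝ → ℝ} (hκ : Continuous κ)
    (h0 : Tendsto κ (cocompact ℝ) (𝓝 0)) : BddAbove (Set.range κ) := by
  obtain ⟨K, hK, hsub⟩ := mem_cocompact.1 (h0.eventually_le_const one_pos)
  obtain ⟨A, hA⟩ := (hK.image hκ).bddAbove
  refine ⟨max A 1, ?_⟩
  rintro _ ⟨x, rfl⟩
  by_cases hx : x ∈ K
  · exact (hA ⟨x, hx, rfl⟩).trans (le_max_left _ _)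
  · exact (hsub hx).trans (le_max_right _ _)

theorem PFSS.exists_isGreenOp_isCompactOperator_of_hF_sq {r q u v u' v' d₁ d₂ : ℝ → ℝ} {p : ℝ≥0∞}
    [Fact (1 ≤ p)] (hp1 : 1 < p) (hp2 : p ≠ ⊤) (h12 : Cond12 r q) (hfss : PFSS r q u v u' v')
    (hd₁ : IsD1 r q d₁) (hd₂ : IsD2 r q d₂)
    (hbdd : BddAbove (Set.range fun x => r x * hF r d₁ d₂ x ^ 2))
    (hlim : Tendsto (fun x => r x * hF r d₁ d₂ x ^ 2) (cocompact ℝ) (𝓝 0)) :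
    ∃ G : LpR p →L[ℝ] LpR p, IsGreenOp u v p G ∧ IsCompactOperator G := by
  have hr := h12.2.2.1
  have hρ : ∀ x, 0 < u x * v x := fun x => mul_pos (hfss.u_pos x) (hfss.v_pos x)
  have hle : ∀ x, r x * (u x * v x) ^ 2 ≤ 16 * (r x * hF r d₁ d₂ x ^ 2) := fun x => by
    have h1 := pow_le_pow_left₀ (hρ x).le (hfss.mul_le_four_mul_hF h12 hd₁ hd₂ x) 2
    linarith [mul_le_mul_of_nonneg_left h1 (hr x).le]
  refine exists_isGreenOp_isCompactOperator_of_blockBound hp1 hp2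
    (κ := fun x => r x * (u x * v x) ^ 2) hfss.continuous_u hfss.continuous_v
    (hfss.continuous_u.mul hfss.continuous_v) hρ ?_ ?_
    fun b hb0 hb1 => ⟨_, fun M S hS hM => hfss.blockBound_mul hr hb0 hb1 M hS hM⟩
  · obtain ⟨A, hA⟩ := hbdd
    refine ⟨16 * A, ?_⟩
    rintro _ ⟨x, rfl⟩
    exact (hle x).trans (by linarith [hA ⟨x, rfl⟩])
  · refine squeeze_zero (fun x => mul_nonneg (hr x).le (sq_nonneg _)) hle ?_
    simpa using hlim.const_mul 16

theorem PFSS.exists_isGreenOp_isCompactOperator_of_hF_mul_abs {r q u v u' v' d₁ d₂ : ℝ → ℝ}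
    {p : ℝ≥0∞} [Fact (1 ≤ p)] (hp1 : 1 < p) (hp2 : p ≠ ⊤) (h12 : Cond12 r q)
    (hfss : PFSS r q u v u' v') (hd₁ : IsD1 r q d₁) (hd₂ : IsD2 r q d₂)
    (hlim : Tendsto (fun x => hF r d₁ d₂ x * |x|) (cocompact ℝ) (𝓝 0)) :
    ∃ G : LpR p →L[ℝ] LpR p, IsGreenOp u v p G ∧ IsCompactOperator G := by
  have hρ : ∀ x, 0 < u x * v x := fun x => mul_pos (hfss.u_pos x) (hfss.v_pos x)
  have hκc : Continuous fun x => u x * v x * (1 + |x|) :=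
    (hfss.continuous_u.mul hfss.continuous_v).mul (continuous_const.add continuous_abs)
  have hκ0 : Tendsto (fun x => u x * v x * (1 + |x|)) (cocompact ℝ) (𝓝 0) := by
    refine squeeze_zero' (g := fun x => 8 * (hF r d₁ d₂ x * |x|))
      (Eventually.of_forall fun x => mul_nonneg (hρ x).le (by positivity)) ?_
      (by simpa using hlim.const_mul 8)
    filter_upwards [(tendsto_norm_cocompact_atTop (E := ℝ)).eventually_ge_atTop 1] with x hx
    rw [Real.norm_eq_abs] at hx
    have h1 := hfss.mul_le_four_mul_hF h12 hd₁ hd₂ x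
    calc u x * v x * (1 + |x|) ≤ 4 * hF r d₁ d₂ x * (|x| + |x|) := by
          have h0 := (hρ x).le.trans h1
          gcongr
      _ = _ := by ring
  exact exists_isGreenOp_isCompactOperator_of_blockBound hp1 hp2
    (κ := fun x => u x * v x * (1 + |x|)) (W := fun x => (1 + |x|)⁻¹) hfss.continuous_u
    hfss.continuous_v
    ((continuous_const.add continuous_abs).inv₀ fun x =>
      (by positivity : 1 + |x| ≠ 0)) (fun x => by positivity)
    (bddAbove_range_of_tendsto_cocompact hκc hκ0) hκ0
    fun b hb0 hb1 => ⟨_, fun M S hS hM => blockBound_inv_one_add_abs hfss.antitone_u hfss.u_pos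
      hfss.monotone_v hfss.v_pos hb0 hb1 M hM hS.measurableSet⟩

/-- **Corollary 3.10.** Assume (1.2), (1.3), let `u, v` be a principal FSS and
`p ∈ (1,∞)`.  If any of the three conditions (1) `sup r h² < ∞` and
`r h² → 0`, (2) `sup r φ ψ < ∞` and `r φ ψ → 0`, (3) `sup h |x| < ∞` and
`h |x| → 0` (as `|x| → ∞`) holds, then the Green operator is bounded and
compact on `L_p(ℝ)`. -/
theorem compact_green_of_three_conditions
    (r q u v u' v' d₁ d₂ : ℝ → ℝ) (p : ℝ≥0∞) (hp1 : 1 < p) (hp2 : p ≠ ⊤)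
    [Fact (1 ≤ p)]
    (h12 : Cond12 r q) (h13 : Cond13 r q) (hfss : PFSS r q u v u' v')
    (hd₁ : IsD1 r q d₁) (hd₂ : IsD2 r q d₂)
    (hcond :
      (BddAbove (Set.range fun x => r x * hF r d₁ d₂ x ^ 2) ∧
        Tendsto (fun x => r x * hF r d₁ d₂ x ^ 2) (cocompact ℝ) (𝓝 0)) ∨
      (BddAbove (Set.range fun x => r x * phiF r d₁ x * psiF r d₂ x) ∧
        Tendsto (fun x => r x * phiF r d₁ x * psiF r d₂ x) (cocompact ℝ) (𝓝 0)) ∨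
      (BddAbove (Set.range fun x => hF r d₁ d₂ x * |x|) ∧
        Tendsto (fun x => hF r d₁ d₂ x * |x|) (cocompact ℝ) (𝓝 0))) :
    ∃ G : LpR p →L[ℝ] LpR p, IsGreenOp u v p G ∧ IsCompactOperator G := by
  rcases hcond with ⟨hb, hl⟩ | ⟨⟨A, hA⟩, hl⟩ | ⟨-, hl⟩
  · exact hfss.exists_isGreenOp_isCompactOperator_of_hF_sq hp1 hp2 h12 hd₁ hd₂ hb hl
  · have hr := h12.2.2.1
    have hle : ∀ x, r x * hF r d₁ d₂ x ^ 2 ≤ r x * phiF r d₁ x * psiF r d₂ x := fun x => by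
      rw [mul_assoc]
      exact mul_le_mul_of_nonneg_left (h12.hF_sq_le hd₁ hd₂ x) (hr x).le
    refine hfss.exists_isGreenOp_isCompactOperator_of_hF_sq hp1 hp2 h12 hd₁ hd₂ ⟨A, ?_⟩
      (squeeze_zero (fun x => mul_nonneg (hr x).le (sq_nonneg _)) hle hl)
    rintro _ ⟨x, rfl⟩
    exact (hle x).trans (hA ⟨x, rfl⟩)
  · exact hfss.exists_isGreenOp_isCompactOperator_of_hF_mul_abs hp1 hp2 h12 hd₁ hd₂ hl
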